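/- arXiv:1507.06174 — 3 statements merged into one kernel-verified Lean document; each statement's English description precedes it below -/
import Mathlib

section
/- Let n ≥ 1 be an integer, t : ℤ → ℂ, and let A be the n×n complex Toeplitz matrix with entries A(i,j) = t(i−j) for i,j ∈ {0,…,n−1}. Suppose A is invertible and that the vectors x = (x_0,…,x_{n−1}) and y = (y_0,…,y_{n−1}) in ℂ^n satisfy A x = e_0 and A y = e_{n−1}, where e_0 = (1,0,…,0)ᵀ and e_{n−1} = (0,…,0,1)ᵀ, and suppose x_0 ≠ 0. Define the n×n matrices M_1(i,j) = x_{i−j} if i ≥ j and 0 otherwise; M_2(i,j) = y_{n−1−(j−i)} if j ≥ i and 0 otherwise; M_3(i,j) = y_{i−j−1} if i > j and 0 otherwise; M_4(i,j) = x_{n−(j−i)} if j > i and 0 otherwise. Then A⁻¹ = (1/x_0)(M_1 M_2 − M_3 M_4). -/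
open Matrix

/-- Lower-triangular Toeplitz matrix with first column `x`. -/
noncomputable def GS_M1 (n : ℕ) (x : Fin n → ℂ) : Matrix (Fin n) (Fin n) ℂ :=
  Matrix.of fun i j => if h : (j : ℕ) ≤ (i : ℕ) then x ⟨(i : ℕ) - (j : ℕ), by omega⟩ else 0

/-- Upper-triangular Toeplitz matrix with first row `(y_{n-1}, y_{n-2}, …, y_0)`. -/
noncomputable def GS_M2 (n : ℕ) (y : Fin n → ℂ) : Matrix (Fin n) (Fin n) ℂ :=
  Matrix.of fun i j => if h : (i : ℕ) ≤ (j : ℕ) then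
      y ⟨n - 1 - ((j : ℕ) - (i : ℕ)), by have := i.2; omega⟩ else 0

/-- Strictly lower-triangular Toeplitz matrix with first column `(0, y_0, …, y_{n-2})`. -/
noncomputable def GS_M3 (n : ℕ) (y : Fin n → ℂ) : Matrix (Fin n) (Fin n) ℂ :=
  Matrix.of fun i j => if h : (j : ℕ) < (i : ℕ) then
      y ⟨(i : ℕ) - (j : ℕ) - 1, by have := i.2; omega⟩ else 0

/-- Strictly upper-triangular Toeplitz matrix with first row `(0, x_{n-1}, …, x_1)`. -/
noncomputable def GS_M4 (n : ℕ) (x : Fin n → ℂ) : Matrix (Fin n) (Fin n) ℂ :=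
  Matrix.of fun i j => if h : (i : ℕ) < (j : ℕ) then
      x ⟨n - ((j : ℕ) - (i : ℕ)), by have := j.2; omega⟩ else 0

section GohbergSemencul

variable {m : ℕ} (x y : Fin (m + 1) → ℂ)

/-- The lower shift matrix, with ones on the first subdiagonal. -/
def lowerShift (m : ℕ) : Matrix (Fin (m + 1)) (Fin (m + 1)) ℂ :=
  Matrix.of fun i j => if (i : ℕ) = (j : ℕ) + 1 then 1 else 0

theorem lowerShift_mul_zero (M : Matrix (Fin (m + 1)) (Fin (m + 1)) ℂ) (j : Fin (m + 1)) :
    (lowerShift m * M) 0 j = 0 := by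
  simp [Matrix.mul_apply, lowerShift]

theorem lowerShift_mul_succ (M : Matrix (Fin (m + 1)) (Fin (m + 1)) ℂ) (i : Fin m)
    (j : Fin (m + 1)) : (lowerShift m * M) i.succ j = M i.castSucc j := by
  rw [Matrix.mul_apply, Finset.sum_eq_single i.castSucc]
  · simp [lowerShift]
  · intro k _ hk
    have : (i : ℕ) ≠ k := fun h => hk (Fin.ext h.symm)
    simp [lowerShift, this]
  · simp

theorem mul_lowerShift_last (M : Matrix (Fin (m + 1)) (Fin (m + 1)) ℂ) (i : Fin (m + 1)) :
    (M * lowerShift m) i (Fin.last m) = 0 := by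
  rw [Matrix.mul_apply]
  refine Finset.sum_eq_zero fun k _ => ?_
  have : (k : ℕ) ≠ m + 1 := k.2.ne
  simp [lowerShift, this]

theorem mul_lowerShift_castSucc (M : Matrix (Fin (m + 1)) (Fin (m + 1)) ℂ) (i : Fin (m + 1))
    (j : Fin m) : (M * lowerShift m) i j.castSucc = M i j.succ := by
  rw [Matrix.mul_apply, Finset.sum_eq_single j.succ]
  · simp [lowerShift]
  · intro k _ hk
    have : (k : ℕ) ≠ j + 1 := fun h => hk (Fin.ext (by simpa using h))
    simp [lowerShift, this]
  · simp

/-- The commutator of a Toeplitz matrix with the shift has rank at most two. -/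
theorem toeplitz_mul_lowerShift_sub {t : ℤ → ℂ} {A : Matrix (Fin (m + 1)) (Fin (m + 1)) ℂ}
    (hA : ∀ i j, A i j = t ((i : ℤ) - (j : ℤ))) :
    ∃ u w : Fin (m + 1) → ℂ, A * lowerShift m - lowerShift m * A =
      vecMulVec (Pi.single 0 1) w - vecMulVec u (Pi.single (Fin.last m) 1) := by
  refine ⟨Fin.cons 0 fun i => A i.castSucc (Fin.last m), Fin.snoc (fun j => A 0 j.succ) 0, ?_⟩
  ext i j
  rw [Matrix.sub_apply, Matrix.sub_apply]
  cases i using Fin.cases with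
  | zero =>
    cases j using Fin.lastCases with
    | last => simp [mul_lowerShift_last, lowerShift_mul_zero, vecMulVec_apply]
    | cast j => simp [mul_lowerShift_castSucc, lowerShift_mul_zero, vecMulVec_apply]
  | succ i =>
    cases j using Fin.lastCases with
    | last => simp [mul_lowerShift_last, lowerShift_mul_succ, vecMulVec_apply]
    | cast j =>
      simp [mul_lowerShift_castSucc, lowerShift_mul_succ, vecMulVec_apply, hA,
        (Fin.castSucc_lt_last j).ne]

theorem toeplitz_inv_rev {t : ℤ → ℂ} {A : Matrix (Fin (m + 1)) (Fin (m + 1)) ℂ}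
    (hA : ∀ i j, A i j = t ((i : ℤ) - (j : ℤ))) (i j : Fin (m + 1)) :
    A⁻¹ i j = A⁻¹ j.rev i.rev := by
  have h : A.submatrix Fin.revPerm Fin.revPerm = Aᵀ := by
    ext i j
    simp only [submatrix_apply, Fin.revPerm_apply, transpose_apply, hA, Fin.val_rev]
    congr 1
    omega
  have h' := inv_submatrix_equiv A Fin.revPerm Fin.revPerm
  rw [h, ← transpose_nonsing_inv] at h'
  simpa using congrFun (congrFun h' j) i

/-- The displacement equation for the inverse of a Toeplitz matrix. -/
theorem toeplitz_inv_succ_succ {t : ℤ → ℂ} {A : Matrix (Fin (m + 1)) (Fin (m + 1)) ℂ}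
    (hA : ∀ i j, A i j = t ((i : ℤ) - (j : ℤ))) (hu : IsUnit A)
    (h0 : A⁻¹ 0 0 ≠ 0) (i j : Fin m) :
    A⁻¹ 0 0 * A⁻¹ i.succ j.succ = A⁻¹ 0 0 * A⁻¹ i.castSucc j.castSucc
      + A⁻¹ i.succ 0 * A⁻¹ 0 j.succ
      - A⁻¹ i.castSucc (Fin.last m) * A⁻¹ (Fin.last m) j.castSucc := by
  obtain ⟨u, w, h⟩ := toeplitz_mul_lowerShift_sub hA
  have hdet := (isUnit_iff_isUnit_det A).1 hu
  have hB : lowerShift m * A⁻¹ - A⁻¹ * lowerShift m =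
      vecMulVec (A⁻¹.col 0) (w ᵥ* A⁻¹) - vecMulVec (A⁻¹ *ᵥ u) (A⁻¹.row (Fin.last m)) := by
    calc lowerShift m * A⁻¹ - A⁻¹ * lowerShift m
        = A⁻¹ * (A * lowerShift m - lowerShift m * A) * A⁻¹ := by
          rw [mul_sub, sub_mul, nonsing_inv_mul_cancel_left _ _ hdet, ← mul_assoc,
            mul_nonsing_inv_cancel_right _ _ hdet]
      _ = _ := by
          rw [h, mul_sub, sub_mul, mul_vecMulVec, mul_vecMulVec, vecMulVec_mul, vecMulVec_mul,
            mulVec_single_one, single_one_vecMul]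
  have e (i j) := congrFun (congrFun hB i) j
  simp only [Matrix.sub_apply, vecMulVec_apply, col_apply, row_apply] at e
  have e₁ := e i.succ j.castSucc
  have e₂ := e 0 j.castSucc
  have e₃ := e i.succ (Fin.last m)
  have e₄ := e 0 (Fin.last m)
  rw [lowerShift_mul_succ, mul_lowerShift_castSucc] at e₁
  rw [lowerShift_mul_zero, mul_lowerShift_castSucc] at e₂
  rw [lowerShift_mul_succ, mul_lowerShift_last] at e₃
  rw [lowerShift_mul_zero, mul_lowerShift_last] at e₄
  have h00 : A⁻¹ (Fin.last m) (Fin.last m) = A⁻¹ 0 0 := by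
    simpa using toeplitz_inv_rev hA (Fin.last m) (Fin.last m)
  rw [h00] at e₃ e₄
  have e₅ : (w ᵥ* A⁻¹) (Fin.last m) = (A⁻¹ *ᵥ u) 0 :=
    mul_left_cancel₀ h0 (by linear_combination -e₄)
  linear_combination -A⁻¹ 0 0 * e₁ + A⁻¹ i.succ 0 * e₂
    + A⁻¹ (Fin.last m) j.castSucc * e₃ + A⁻¹ i.succ 0 * A⁻¹ (Fin.last m) j.castSucc * e₅

theorem gohbergSemencul_apply_zero (i : Fin (m + 1)) :
    (GS_M1 (m + 1) x * GS_M2 (m + 1) y - GS_M3 (m + 1) y * GS_M4 (m + 1) x) i 0 =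
      x i * y (Fin.last m) := by
  simp [Matrix.mul_apply, GS_M1, GS_M2, GS_M4, Fin.last]

theorem gohbergSemencul_zero_apply (j : Fin (m + 1)) :
    (GS_M1 (m + 1) x * GS_M2 (m + 1) y - GS_M3 (m + 1) y * GS_M4 (m + 1) x) 0 j =
      x 0 * y j.rev := by
  simp [Matrix.mul_apply, Fin.sum_univ_succ, GS_M1, GS_M2, GS_M3, Fin.rev]

theorem gohbergSemencul_succ_succ (i j : Fin m) :
    (GS_M1 (m + 1) x * GS_M2 (m + 1) y - GS_M3 (m + 1) y * GS_M4 (m + 1) x) i.succ j.succ =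
      (GS_M1 (m + 1) x * GS_M2 (m + 1) y - GS_M3 (m + 1) y * GS_M4 (m + 1) x)
        i.castSucc j.castSucc
      + x i.succ * y j.succ.rev - y i.castSucc * x j.castSucc.rev := by
  have h₂ : GS_M2 (m + 1) y (Fin.last m) j.castSucc = 0 := by simp [GS_M2]
  have h₄ : GS_M4 (m + 1) x (Fin.last m) j.castSucc = 0 :=
    dif_neg j.castSucc.le_last.not_gt
  have hs : x i.succ = x ⟨i + 1, by omega⟩ := rfl
  simp only [Matrix.sub_apply, Matrix.mul_apply]
  rw [Fin.sum_univ_succ, Fin.sum_univ_succ, Fin.sum_univ_castSucc, Fin.sum_univ_castSucc, h₂, h₄, hs]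
  simp [GS_M1, GS_M2, GS_M3, GS_M4, Fin.rev, Fin.castSucc, Fin.castAdd, Fin.castLE]
  ring

end GohbergSemencul

/-- **Gohberg–Semencul formula.**  If `A` is an invertible `n × n` Toeplitz matrix,
`A x = e₀`, `A y = e_{n-1}`, and `x₀ ≠ 0`, then
`A⁻¹ = (1/x₀) (M₁ M₂ - M₃ M₄)`. -/
theorem gohberg_semencul
    (n : ℕ) (hn : 1 ≤ n) (t : ℤ → ℂ) (A : Matrix (Fin n) (Fin n) ℂ)
    (hToeplitz : ∀ i j : Fin n, A i j = t ((i : ℤ) - (j : ℤ)))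
    (hA : IsUnit A)
    (x y : Fin n → ℂ)
    (hx : A.mulVec x = fun i : Fin n => if (i : ℕ) = 0 then 1 else 0)
    (hy : A.mulVec y = fun i : Fin n => if (i : ℕ) = n - 1 then 1 else 0)
    (hx0 : x ⟨0, hn⟩ ≠ 0) :
    A⁻¹ = (x ⟨0, hn⟩)⁻¹ • (GS_M1 n x * GS_M2 n y - GS_M3 n y * GS_M4 n x) := by
  obtain ⟨m, rfl⟩ : ∃ m, n = m + 1 := ⟨n - 1, by omega⟩
  have hdet := (isUnit_iff_isUnit_det A).1 hA
  have hx' : A⁻¹.col 0 = x := by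
    have h : A *ᵥ x = Pi.single 0 1 := by
      rw [hx]; ext i; simp [Pi.single_apply]
    rw [← mulVec_single_one, ← h, mulVec_mulVec, nonsing_inv_mul _ hdet, one_mulVec]
  have hy' : A⁻¹.col (Fin.last m) = y := by
    have h : A *ᵥ y = Pi.single (Fin.last m) 1 := by
      rw [hy]; ext i; simp [Pi.single_apply, Fin.ext_iff]
    rw [← mulVec_single_one, ← h, mulVec_mulVec, nonsing_inv_mul _ hdet, one_mulVec]
  have hxi (i) : A⁻¹ i 0 = x i := congrFun hx' i
  have hyi (i) : A⁻¹ i (Fin.last m) = y i := congrFun hy' i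
  have hx_rev (j) : A⁻¹ (Fin.last m) j = x j.rev := by
    rw [toeplitz_inv_rev hToeplitz, Fin.rev_last, hxi]
  have hy_rev (j) : A⁻¹ 0 j = y j.rev := by
    rw [toeplitz_inv_rev hToeplitz, Fin.rev_zero, hyi]
  have hxy : y (Fin.last m) = x 0 := by rw [← hxi, hy_rev, Fin.rev_zero]
  rw [eq_inv_smul_iff₀ hx0]
  ext i j
  rw [Matrix.smul_apply, smul_eq_mul]
  change x 0 * _ = _
  induction j using Fin.induction generalizing i with
  | zero => rw [gohbergSemencul_apply_zero, hxi, hxy, mul_comm]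
  | succ j ih =>
    cases i using Fin.cases with
    | zero => rw [gohbergSemencul_zero_apply, hy_rev]
    | succ i =>
      rw [gohbergSemencul_succ_succ, ← ih, ← hxi 0,
        toeplitz_inv_succ_succ hToeplitz hA (by rw [hxi]; exact hx0), hxi i.succ,
        hy_rev j.succ, hyi, hx_rev]
end

section
/- Let n be an even positive integer, q a positive integer, and m = qn+1. Let I : {−n/2,…,n/2−1}³ → ℂ be a volume and let Î(ω_x,ω_y,ω_z) = Σ_{u,v,w=−n/2}^{n/2−1} I(u,v,w) exp(2πi(uω_x+vω_y+wω_z)/m) be its discrete-time Fourier transform. If Î(qa, qb, qc) = 0 for all integers a,b,c ∈ {−n/2,…,n/2}, then I = 0. That is, a volume is uniquely determined by the samples of its discrete-time Fourier transform on the decimated Cartesian grid Ω_c = {(qu,qv,qw) : u,v,w ∈ ℤ, −n/2 ≤ u,v,w ≤ n/2}. -/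
/-- The discrete-time Fourier transform of an `n × n × n` volume (`m = qn+1`):
`Î(ωx,ωy,ωz) = ∑_{u,v,w=-n/2}^{n/2-1} I(u,v,w) exp(2πi(u ωx + v ωy + w ωz)/m)`,
where `u, v, w : Fin n` encode the indices `u - n/2`, `v - n/2`, `w - n/2`. -/
noncomputable def dtft3 (n q : ℕ) (V : Fin n → Fin n → Fin n → ℂ)
    (ωx ωy ωz : ℝ) : ℂ :=
  ∑ u : Fin n, ∑ v : Fin n, ∑ w : Fin n,
    V u v w * Complex.exp (2 * Real.pi * Complex.I *
      ((((u : ℕ) : ℂ) - (n : ℂ) / 2) * ωx + (((v : ℕ) : ℂ) - (n : ℂ) / 2) * ωy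
        + (((w : ℕ) : ℂ) - (n : ℂ) / 2) * ωz) / ((q : ℂ) * n + 1))

/-- The one-dimensional Fourier kernel `exp(2πi (u - n/2) qa / (qn+1))` sampled at the decimated
frequency `qa`. -/
noncomputable def decimatedKernel (n q : ℕ) (u : Fin n) (a : ℤ) : ℂ :=
  Complex.exp (2 * Real.pi * Complex.I *
    ((((u : ℕ) : ℂ) - (n : ℂ) / 2) * (q * a)) / ((q : ℂ) * n + 1))

lemma decimatedKernel_eq_pow {n q : ℕ} (u : Fin n) (a : ℤ) :
    decimatedKernel n q u a =
      Complex.exp (2 * Real.pi * Complex.I * (q / (q * n + 1 : ℕ)) * a) ^ (u : ℕ) *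
      Complex.exp (-(2 * Real.pi * Complex.I * (n / 2) * (q * a)) / ((q : ℂ) * n + 1)) := by
  rw [decimatedKernel, ← Complex.exp_nat_mul, ← Complex.exp_add]
  congr 1
  push_cast
  ring

/-- A signal of length `n` is determined by the samples of its Fourier transform at the
decimated frequencies. -/
lemma eq_zero_of_sum_decimatedKernel_eq_zero {n q : ℕ} (hne : Even n) (hq : 0 < q) {f : Fin n → ℂ}
    (h : ∀ a : ℤ, |a| ≤ (n : ℤ) / 2 → ∑ u, f u * decimatedKernel n q u a = 0) (u : Fin n) :
    f u = 0 := by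
  obtain ⟨k, hk⟩ := hne
  have hζ : IsPrimitiveRoot (Complex.exp (2 * Real.pi * Complex.I * (q / (q * n + 1 : ℕ))))
      (q * n + 1) :=
    Complex.isPrimitiveRoot_exp_of_coprime q _ (by simp) (by simp)
  set ζ := Complex.exp (2 * Real.pi * Complex.I * (q / (q * n + 1 : ℕ))) with hζ_def
  have hexp (a : ℤ) :
      Complex.exp (2 * Real.pi * Complex.I * (q / (q * n + 1 : ℕ)) * a) = ζ ^ a := by
    rw [hζ_def, ← Complex.exp_int_mul, mul_comm]
  have hζ0 : ζ ≠ 0 := Complex.exp_ne_zero _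
  have hlt (j : Fin n) : (j : ℕ) < q * n + 1 :=
    j.isLt.trans (Nat.lt_succ_of_le (Nat.le_mul_of_pos_left n hq))
  have hinj : Function.Injective fun j : Fin n => ζ ^ ((j : ℤ) - k) := by
    intro i j hij
    simp only [zpow_sub₀ hζ0, zpow_natCast] at hij
    exact Fin.ext (hζ.pow_inj (hlt i) (hlt j) ((div_left_inj' (pow_ne_zero _ hζ0)).1 hij))
  refine congrFun (Matrix.eq_zero_of_forall_index_sum_mul_pow_eq_zero hinj fun j => ?_) u
  have hj := h ((j : ℤ) - k) (by rw [abs_le]; omega)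
  simp only [decimatedKernel_eq_pow, hexp, ← mul_assoc, ← Finset.sum_mul] at hj
  exact (mul_eq_zero.1 hj).resolve_right (Complex.exp_ne_zero _)

lemma dtft3_decimated (n q : ℕ) (V : Fin n → Fin n → Fin n → ℂ) (a b c : ℤ) :
    dtft3 n q V ((q : ℝ) * a) ((q : ℝ) * b) ((q : ℝ) * c) =
      ∑ u, (∑ v, (∑ w, V u v w * decimatedKernel n q w c) * decimatedKernel n q v b) *
        decimatedKernel n q u a := by
  simp only [dtft3, Finset.sum_mul, decimatedKernel, mul_assoc (V _ _ _), ← Complex.exp_add]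
  refine Finset.sum_congr rfl fun u _ => Finset.sum_congr rfl fun v _ =>
    Finset.sum_congr rfl fun w _ => ?_
  congr 2
  push_cast
  ring

/-- **Injectivity on the decimated Cartesian grid.**  If the discrete-time Fourier
transform of a volume vanishes at all points `(qa, qb, qc)` with integers
`|a|, |b|, |c| ≤ n/2`, then the volume is zero. -/
theorem dtft3_vanishing_on_decimated_grid
    (n : ℕ) (hn : 0 < n) (hne : Even n) (q : ℕ) (hq : 0 < q)
    (V : Fin n → Fin n → Fin n → ℂ)
    (h : ∀ a b c : ℤ, |a| ≤ (n : ℤ) / 2 → |b| ≤ (n : ℤ) / 2 → |c| ≤ (n : ℤ) / 2 →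
      dtft3 n q V ((q : ℝ) * a) ((q : ℝ) * b) ((q : ℝ) * c) = 0) :
    ∀ u v w : Fin n, V u v w = 0 := by
  simp only [dtft3_decimated] at h
  intro u v w
  refine eq_zero_of_sum_decimatedKernel_eq_zero hne hq (fun c hc => ?_) w
  refine eq_zero_of_sum_decimatedKernel_eq_zero
    (f := fun v => ∑ w, V u v w * decimatedKernel n q w c) hne hq (fun b hb => ?_) v
  exact eq_zero_of_sum_decimatedKernel_eq_zero
    (f := fun u => ∑ v, (∑ w, V u v w * decimatedKernel n q w c) * decimatedKernel n q v b)
    hne hq (fun a ha => h a b c ha hb hc) u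
end

section
/- Let n be an even positive integer, q a positive integer, and m = qn+1. Let I : {−n/2,…,n/2−1}³ → ℂ be a volume and let Î(ω_x,ω_y,ω_z) = Σ_{u,v,w=−n/2}^{n/2−1} I(u,v,w) exp(2πi(uω_x+vω_y+wω_z)/m) be its discrete-time Fourier transform. Suppose Î vanishes at every point of the three-dimensional pseudo-polar grid, i.e., Î(k, −(2l/n)k, −(2j/n)k) = 0, Î(−(2l/n)k, k, −(2j/n)k) = 0, and Î(−(2l/n)k, −(2j/n)k, k) = 0 for all integers l, j with |l|, |j| ≤ n/2 and all integers k with |k| ≤ qn/2. Then I = 0. That is, the three-dimensional pseudo-polar Fourier transform is injective. -/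
/-- The character `x ↦ exp(2πi (u - n/2) x / (qn+1))`. -/
noncomputable def centeredChar (n q : ℕ) (u : Fin n) (x : ℝ) : ℂ :=
  Complex.exp (2 * Real.pi * Complex.I * ((((u : ℕ) : ℂ) - (n : ℂ) / 2) * x) / ((q : ℂ) * n + 1))

theorem dtft3_eq_sum_centeredChar (n q : ℕ) (V : Fin n → Fin n → Fin n → ℂ) (x y z : ℝ) :
    dtft3 n q V x y z = ∑ w, (∑ v, (∑ u, V u v w * centeredChar n q u x) *
      centeredChar n q v y) * centeredChar n q w z := by
  unfold dtft3 centeredChar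
  simp only [Finset.sum_mul]
  rw [Finset.sum_congr rfl fun u _ => Finset.sum_comm, Finset.sum_comm]
  refine Finset.sum_congr rfl fun w _ => ?_
  rw [Finset.sum_comm]
  refine Finset.sum_congr rfl fun v _ => Finset.sum_congr rfl fun u _ => ?_
  rw [mul_assoc (V u v w), ← Complex.exp_add, mul_assoc (V u v w), ← Complex.exp_add]
  congr 2
  ring

/-- A trigonometric polynomial with `n` coefficients vanishing at `n` distinct points of an
interval shorter than its period `qn+1` is zero. -/
theorem eq_zero_of_sum_mul_centeredChar_eq_zero (n q : ℕ) (c : Fin n → ℂ) (x : Fin n → ℝ)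
    (hinj : Function.Injective x) (hx : ∀ i, |x i| ≤ (q : ℝ) * n / 2)
    (h : ∀ i, ∑ u, c u * centeredChar n q u (x i) = 0) (u : Fin n) : c u = 0 := by
  have hM : (0 : ℝ) < (q : ℝ) * n + 1 := by positivity
  have hMc : ((q : ℂ) * n + 1) ≠ 0 := by exact_mod_cast hM.ne'
  have hf : Function.Injective
      (fun i => Complex.exp (2 * Real.pi * Complex.I * (x i) / ((q : ℂ) * n + 1))) := by
    intro i j hij
    obtain ⟨k, hk⟩ := Complex.exp_eq_exp_iff_exists_int.1 hij
    have hpi : (2 * Real.pi * Complex.I : ℂ) ≠ 0 := Complex.two_pi_I_ne_zero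
    have h1 : (x i : ℂ) = x j + k * ((q : ℂ) * n + 1) := by
      field_simp at hk
      linear_combination hk
    have h2 : x i = x j + k * ((q : ℝ) * n + 1) := by exact_mod_cast h1
    have hi := abs_le.1 (hx i)
    have hj := abs_le.1 (hx j)
    have hk1 : (k : ℝ) < 1 := by
      by_contra! hc
      nlinarith
    have hk2 : (-1 : ℝ) < k := by
      by_contra! hc
      nlinarith
    have hk0 : k = 0 := by
      have : k < 1 := by exact_mod_cast hk1
      have : -1 < k := by exact_mod_cast hk2
      omega
    apply hinj
    simpa [hk0] using h2
  refine congrFun (Matrix.eq_zero_of_forall_index_sum_mul_pow_eq_zero hf fun j => ?_) u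
  have hfac : ∀ i : Fin n,
      Complex.exp (2 * Real.pi * Complex.I * (x j) / ((q : ℂ) * n + 1)) ^ (i : ℕ) =
        Complex.exp (2 * Real.pi * Complex.I * ((n : ℂ) / 2 * x j) / ((q : ℂ) * n + 1)) *
          centeredChar n q i (x j) := by
    intro i
    rw [centeredChar, ← Complex.exp_nat_mul, ← Complex.exp_add]
    congr 1
    ring
  simp only [hfac, mul_left_comm (c _)]
  rw [← Finset.mul_sum, h j, mul_zero]

/-- **Injectivity of the 3D pseudo-polar Fourier transform.**  If the discrete-time
Fourier transform of a volume vanishes at every point of the three-dimensional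
pseudo-polar grid, i.e. at `(k, -(2l/n)k, -(2j/n)k)`, `(-(2l/n)k, k, -(2j/n)k)` and
`(-(2l/n)k, -(2j/n)k, k)` for all integers `|l|, |j| ≤ n/2` and `|k| ≤ qn/2`, then
the volume is zero. -/
theorem ppft3_injective
    (n : ℕ) (hn : 0 < n) (hne : Even n) (q : ℕ) (hq : 0 < q)
    (V : Fin n → Fin n → Fin n → ℂ)
    (hx : ∀ k l j : ℤ, |l| ≤ (n : ℤ) / 2 → |j| ≤ (n : ℤ) / 2 → |k| ≤ (q : ℤ) * n / 2 →
      dtft3 n q V ((k : ℝ)) (-(2 * (l : ℝ) / n) * k) (-(2 * (j : ℝ) / n) * k) = 0)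
    (hy : ∀ k l j : ℤ, |l| ≤ (n : ℤ) / 2 → |j| ≤ (n : ℤ) / 2 → |k| ≤ (q : ℤ) * n / 2 →
      dtft3 n q V (-(2 * (l : ℝ) / n) * k) ((k : ℝ)) (-(2 * (j : ℝ) / n) * k) = 0)
    (hz : ∀ k l j : ℤ, |l| ≤ (n : ℤ) / 2 → |j| ≤ (n : ℤ) / 2 → |k| ≤ (q : ℤ) * n / 2 →
      dtft3 n q V (-(2 * (l : ℝ) / n) * k) (-(2 * (j : ℝ) / n) * k) ((k : ℝ)) = 0) :
    ∀ u v w : Fin n, V u v w = 0 := by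
  obtain ⟨h, hh⟩ := hne
  have hnh : (n : ℝ) = h + h := by exact_mod_cast hh
  have hhR : (0 : ℝ) < h := by
    have : 0 < h := by omega
    exact_mod_cast this
  have hn0 : (n : ℝ) ≠ 0 := by positivity
  have hslope : ∀ i : Fin n, |((i : ℤ) - h : ℤ)| ≤ (n : ℤ) / 2 := fun i => by
    have := i.2
    rw [abs_le]; omega
  have hqn : (h : ℤ) ≤ (q : ℤ) * n / 2 := by
    have : (n : ℤ) ≤ q * n := by exact_mod_cast Nat.le_mul_of_pos_left n hq
    omega
  have hnode : ∀ k : ℤ, k ≠ 0 → |k| ≤ (q : ℤ) * n / 2 →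
      Function.Injective (fun i : Fin n => -(2 * (((i : ℤ) - h : ℤ) : ℝ) / n) * (k : ℝ)) ∧
      ∀ i : Fin n, |-(2 * (((i : ℤ) - h : ℤ) : ℝ) / n) * (k : ℝ)| ≤ (q : ℝ) * n / 2 := by
    intro k hk hkb
    have hkR : (k : ℝ) ≠ 0 := by exact_mod_cast hk
    constructor
    · intro i j hij
      have h1 := mul_right_cancel₀ hkR hij
      field_simp at h1
      have h2 : (((i : ℤ) - h : ℤ) : ℝ) = (((j : ℤ) - h : ℤ) : ℝ) := by linarith
      have h3 : ((i : ℤ) - h : ℤ) = (j : ℤ) - h := by exact_mod_cast h2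
      ext
      omega
    · intro i
      have h1 : |(((i : ℤ) - h : ℤ) : ℝ)| ≤ h := by
        have := hslope i
        have : |((i : ℤ) - h : ℤ)| ≤ h := by omega
        exact_mod_cast this
      have h2 : |-(2 * (((i : ℤ) - h : ℤ) : ℝ) / n)| ≤ 1 := by
        rw [abs_neg, abs_div, abs_mul, abs_two, Nat.abs_cast, div_le_one (by positivity)]
        linarith
      have h3 : |(k : ℝ)| ≤ (q : ℝ) * n / 2 := by
        have : 2 * |k| ≤ (q : ℤ) * n := by omega
        have : 2 * |(k : ℝ)| ≤ (q : ℝ) * n := by exact_mod_cast this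
        linarith
      rw [abs_mul]
      exact (mul_le_of_le_one_left (abs_nonneg _) h2).trans h3
  have hplane : ∀ k : ℤ, k ≠ 0 → |k| ≤ (q : ℤ) * n / 2 → ∀ v w : Fin n,
      ∑ u, V u v w * centeredChar n q u k = 0 := by
    intro k hk hkb v w
    obtain ⟨hinj, hbd⟩ := hnode k hk hkb
    refine eq_zero_of_sum_mul_centeredChar_eq_zero n q
      (fun v => ∑ u, V u v w * centeredChar n q u k) _ hinj hbd (fun l => ?_) v
    refine eq_zero_of_sum_mul_centeredChar_eq_zero n q
      (fun w => ∑ v, (∑ u, V u v w * centeredChar n q u k) * centeredChar n q v _)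
      _ hinj hbd (fun j => ?_) w
    rw [← dtft3_eq_sum_centeredChar]
    exact hx k _ _ (hslope l) (hslope j) hkb
  intro u v w
  let κ : Fin n → ℤ := fun i => if (i : ℕ) < h then (i : ℤ) - h else (i : ℤ) - h + 1
  have hκ : ∀ i, κ i ≠ 0 ∧ |κ i| ≤ (q : ℤ) * n / 2 := by
    intro i
    have := i.2
    simp only [κ, abs_le]
    split_ifs <;> omega
  refine eq_zero_of_sum_mul_centeredChar_eq_zero n q (fun u => V u v w) (fun i => (κ i : ℝ))
    (fun i j hij => ?_) (fun i => ?_) (fun i => hplane (κ i) (hκ i).1 (hκ i).2 v w) u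
  · have h1 : κ i = κ j := Int.cast_injective hij
    simp only [κ] at h1
    ext
    split_ifs at h1 <;> omega
  · have h1 := (hκ i).2
    have : 2 * |κ i| ≤ (q : ℤ) * n := by omega
    have : 2 * |(κ i : ℝ)| ≤ (q : ℝ) * n := by exact_mod_cast this
    linarith
end
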